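/- There exist real numbers d(p₀) and D(p₀) with −b ≤ d(p₀) ≤ D(p₀) ≤ b such that the relativistic pendulum equation (φ(x'(t)))' + a·x'(t) + b·sin(x(t)) = p₀(t) + s has a T-periodic solution if and only if s ∈ [d(p₀), D(p₀)]. Equivalently, the solvability set I(p₀) is a nonempty compact interval contained in [−b, b]. -/

import Mathlib

open Real Set MeasureTheory

/-- The relativistic operator `φ(v) = v / √(1 - v²/c²)`. -/
noncomputable def phi (c v : ℝ) : ℝ := v / Real.sqrt (1 - v ^ 2 / c ^ 2)

/-- `x` is a `T`-periodic solution of the relativistic pendulum equation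
`(φ(x'))' + a x' + b sin x = p`. -/
def IsPendSol (c a b T : ℝ) (p x : ℝ → ℝ) : Prop :=
  Function.Periodic x T ∧
  ContDiff ℝ 1 x ∧
  (∀ t : ℝ, |deriv x t| < c) ∧
  ContDiff ℝ 1 (fun t : ℝ => phi c (deriv x t)) ∧
  ∀ t : ℝ, deriv (fun τ : ℝ => phi c (deriv x τ)) t + a * deriv x t + b * Real.sin (x t) = p t

/-- The solvability set `I(p₀)`: the values `s` for which the relativistic pendulum
equation with forcing `p₀ + s` has a `T`-periodic solution. -/
def solvSet (c a b T : ℝ) (p₀ : ℝ → ℝ) : Set ℝ :=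
  {s : ℝ | ∃ x : ℝ → ℝ, IsPendSol c a b T (fun t => p₀ t + s) x}

lemma edge_lt {h : ℝ → ℝ} (hh : Continuous h) {p q δ : ℝ}
    (hpos : ∀ t ∈ Set.uIcc p q, 0 < Real.cos (h t - δ)) (hs : 0 < Real.sin (h q - h p)) :
    h p < h q := by
  by_contra hcon
  push Not at hcon
  have hlt : -Real.pi < h q - h p := by
    by_contra hc2
    push Not at hc2
    have : h p - Real.pi ∈ h '' Set.uIcc p q := by
      apply intermediate_value_uIcc hh.continuousOn
      rw [Set.mem_uIcc]
      right
      constructor <;> linarith [Real.pi_pos]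
    obtain ⟨t, ht, hte⟩ := this
    have h1 := hpos t ht
    have h2 := hpos p Set.left_mem_uIcc
    rw [hte, show h p - Real.pi - δ = (h p - δ) - Real.pi by ring, Real.cos_sub_pi] at h1
    linarith
  have := Real.sin_nonpos_of_nonpos_of_neg_pi_le (by linarith : h q - h p ≤ 0) hlt.le
  linarith

lemma poincare_miranda (f g : ℝ × ℝ → ℝ) (hf : Continuous f) (hg : Continuous g) (M R : ℝ)
    (hM : 0 ≤ M) (hR : 0 ≤ R)
    (hf1 : ∀ v ∈ Set.Icc (-R) R, 0 < f (M, v)) (hf0 : ∀ v ∈ Set.Icc (-R) R, f (-M, v) < 0)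
    (hg1 : ∀ u ∈ Set.Icc (-M) M, 0 < g (u, R)) (hg0 : ∀ u ∈ Set.Icc (-M) M, g (u, -R) < 0) :
    ∃ u ∈ Set.Icc (-M) M, ∃ v ∈ Set.Icc (-R) R, f (u, v) = 0 ∧ g (u, v) = 0 := by
  by_contra hcon
  push Not at hcon
  let π₁ : ℝ → ℝ := fun u => max (-M) (min u M)
  let π₂ : ℝ → ℝ := fun u => max (-R) (min u R)
  have hπ₁ : ∀ u, π₁ u ∈ Set.Icc (-M) M := fun u =>
    ⟨le_max_left _ _, max_le (by linarith) (min_le_right _ _)⟩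
  have hπ₂ : ∀ u, π₂ u ∈ Set.Icc (-R) R := fun u =>
    ⟨le_max_left _ _, max_le (by linarith) (min_le_right _ _)⟩
  have eπ₁ : ∀ u ∈ Set.Icc (-M) M, π₁ u = u := fun u hu => by
    simp only [π₁]; rw [min_eq_left hu.2, max_eq_right hu.1]
  have eπ₂ : ∀ u ∈ Set.Icc (-R) R, π₂ u = u := fun u hu => by
    simp only [π₂]; rw [min_eq_left hu.2, max_eq_right hu.1]
  have cπ₁ : Continuous π₁ := by fun_prop
  have cπ₂ : Continuous π₂ := by fun_prop
  let F : C(ℝ × ℝ, ℂ) := ⟨fun z => (f (π₁ z.1, π₂ z.2) : ℂ) + (g (π₁ z.1, π₂ z.2) : ℂ) * Complex.I,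
    by fun_prop⟩
  have Fre : ∀ z, (F z).re = f (π₁ z.1, π₂ z.2) := fun z => by simp [F]
  have Fim : ∀ z, (F z).im = g (π₁ z.1, π₂ z.2) := fun z => by simp [F]
  have F0 : ∀ z, F z ≠ 0 := by
    intro z hz
    have h1 := Fre z
    have h2 := Fim z
    rw [hz] at h1 h2
    exact hcon _ (hπ₁ z.1) _ (hπ₂ z.2) h1.symm h2.symm
  obtain ⟨G, ⟨-, hG⟩, -⟩ := Complex.isCoveringMapOn_exp.existsUnique_continuousMap_lifts
    F (a₀ := (0, 0)) (e₀ := Complex.log (F (0, 0))) (Complex.exp_log (F0 _)) (fun a => F0 a)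
  have hG' : ∀ z, Complex.exp (G z) = F z := fun z => congrFun hG z
  have cG : Continuous fun z => (G z).im := Complex.continuous_im.comp G.continuous
  have ere : ∀ u ∈ Set.Icc (-M) M, ∀ v ∈ Set.Icc (-R) R,
      f (u, v) = Real.exp (G (u, v)).re * Real.cos (G (u, v)).im := fun u hu v hv => by
    rw [← Complex.exp_re, hG', Fre]; simp [eπ₁ u hu, eπ₂ v hv]
  have eim : ∀ u ∈ Set.Icc (-M) M, ∀ v ∈ Set.Icc (-R) R,
      g (u, v) = Real.exp (G (u, v)).re * Real.sin (G (u, v)).im := fun u hu v hv => by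
    rw [← Complex.exp_im, hG', Fim]; simp [eπ₁ u hu, eπ₂ v hv]
  have mM : M ∈ Set.Icc (-M) M := ⟨by linarith, le_rfl⟩
  have mM' : -M ∈ Set.Icc (-M) M := ⟨le_rfl, by linarith⟩
  have mR : R ∈ Set.Icc (-R) R := ⟨by linarith, le_rfl⟩
  have mR' : -R ∈ Set.Icc (-R) R := ⟨le_rfl, by linarith⟩
  have c1 : ∀ v ∈ Set.Icc (-R) R, 0 < Real.cos (G (M, v)).im := fun v hv => by
    have := hf1 v hv
    rw [ere _ mM _ hv] at this
    exact pos_of_mul_pos_right this (Real.exp_pos _).le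
  have c0 : ∀ v ∈ Set.Icc (-R) R, Real.cos (G (-M, v)).im < 0 := fun v hv => by
    have := hf0 v hv
    rw [ere _ mM' _ hv] at this
    exact neg_of_mul_neg_right this (Real.exp_pos _).le
  have s1 : ∀ u ∈ Set.Icc (-M) M, 0 < Real.sin (G (u, R)).im := fun v hv => by
    have := hg1 v hv
    rw [eim _ hv _ mR] at this
    exact pos_of_mul_pos_right this (Real.exp_pos _).le
  have s0 : ∀ u ∈ Set.Icc (-M) M, Real.sin (G (u, -R)).im < 0 := fun v hv => by
    have := hg0 v hv
    rw [eim _ hv _ mR'] at this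
    exact neg_of_mul_neg_right this (Real.exp_pos _).le
  have a1 := c1 _ mR
  have a2 := c1 _ mR'
  have a3 := c0 _ mR
  have a4 := c0 _ mR'
  have b1 := s1 _ mM
  have b2 := s1 _ mM'
  have b3 := s0 _ mM
  have b4 := s0 _ mM'
  have uR : Set.uIcc (-R) R = Set.Icc (-R) R := Set.uIcc_of_le (by linarith)
  have uM : Set.uIcc (-M) M = Set.Icc (-M) M := Set.uIcc_of_le (by linarith)
  have e1 : (G (M, -R)).im < (G (M, R)).im :=
    edge_lt (h := fun v => (G (M, v)).im) (δ := 0) (by fun_prop) (p := -R) (q := R)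
      (fun t ht => by rw [uR] at ht; simpa using c1 t ht)
      (by rw [Real.sin_sub]; nlinarith)
  have e2 : (G (M, R)).im < (G (-M, R)).im :=
    edge_lt (h := fun v => (G (v, R)).im) (δ := Real.pi / 2) (by fun_prop) (p := M) (q := -M)
      (fun t ht => by
        rw [Set.uIcc_comm, uM] at ht; rw [Real.cos_sub_pi_div_two]; exact s1 t ht)
      (by rw [Real.sin_sub]; nlinarith)
  have e3 : (G (-M, R)).im < (G (-M, -R)).im :=
    edge_lt (h := fun v => (G (-M, v)).im) (δ := Real.pi) (by fun_prop) (p := R) (q := -R)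
      (fun t ht => by
        rw [Set.uIcc_comm, uR] at ht; rw [Real.cos_sub_pi]; linarith [c0 t ht])
      (by rw [Real.sin_sub]; nlinarith)
  have e4 : (G (-M, -R)).im < (G (M, -R)).im :=
    edge_lt (h := fun v => (G (v, -R)).im) (δ := -(Real.pi / 2)) (by fun_prop) (p := -M) (q := M)
      (fun t ht => by
        rw [uM] at ht; rw [sub_neg_eq_add, Real.cos_add_pi_div_two]; linarith [s0 t ht])
      (by rw [Real.sin_sub]; nlinarith)
  linarith

lemma global_flow {E : Type*} [NormedAddCommGroup E] [NormedSpace ℝ E] [CompleteSpace E]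
    (v : ℝ → E → E) (K L : NNReal) (hv : ∀ t, LipschitzWith K (v t))
    (hc : ∀ x, Continuous fun t => v t x) (hb : ∀ t x, ‖v t x‖ ≤ L) :
    ∃ Φ : E → ℝ → E, (∀ x, Φ x 0 = x) ∧ (∀ x t, HasDerivAt (Φ x) (v t (Φ x t)) t) ∧
      ∀ t, 0 ≤ t → Continuous fun x => Φ x t := by
  have loc : ∀ (x : E) (n : ℕ), ∃ α : ℝ → E, α 0 = x ∧
      ∀ t ∈ Set.Ioo (-(n + 1) : ℝ) (n + 1), HasDerivAt α (v t (α t)) t := by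
    intro x n
    have hn : (0 : ℝ) < n + 1 := by positivity
    have h0 : (0 : ℝ) ∈ Set.Icc (-(n + 1) : ℝ) (n + 1) := ⟨by linarith, hn.le⟩
    have pl : IsPicardLindelof v (⟨0, h0⟩ : Set.Icc (-(n + 1) : ℝ) (n + 1)) x
        (L * ((n : NNReal) + 1)) 0 L K :=
      { lipschitzOnWith := fun t _ => (hv t).lipschitzOnWith
        continuousOn := fun y _ => (hc y).continuousOn
        norm_le := fun t _ y _ => hb t y
        mul_max_le := by simp }
    obtain ⟨α, h1, h2⟩ := pl.exists_eq_forall_mem_Icc_hasDerivWithinAt₀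
    exact ⟨α, h1, fun t ht => (h2 t (Set.Ioo_subset_Icc_self ht)).hasDerivAt
      (Icc_mem_nhds ht.1 ht.2)⟩
  choose α hα0 hα using loc
  have agree : ∀ x (n m : ℕ), n ≤ m → ∀ t ∈ Set.Ioo (-(n + 1) : ℝ) (n + 1), α x n t = α x m t := by
    intro x n m hnm t ht
    have hnm' : (n : ℝ) ≤ m := by exact_mod_cast hnm
    have hn : (0 : ℝ) < n + 1 := by positivity
    refine ODE_solution_unique_of_mem_Ioo (v := v) (K := K) (s := fun _ => Set.univ) (t₀ := 0)
      (a := -(n + 1)) (b := n + 1)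
      (fun t _ => (hv t).lipschitzOnWith) ⟨by linarith, hn⟩
      (fun t ht => ⟨hα x n t ht, trivial⟩)
      (fun t ht => ⟨hα x m t ⟨by linarith [ht.1], by linarith [ht.2]⟩, trivial⟩) ?_ ht
    rw [hα0, hα0]
  let Φ : E → ℝ → E := fun x t => α x ⌈|t|⌉₊ t
  have hΦ : ∀ x (n : ℕ), ∀ t ∈ Set.Ioo (-(n + 1) : ℝ) (n + 1), Φ x t = α x n t := by
    intro x n t ht
    have h1 : |t| ≤ ⌈|t|⌉₊ := Nat.le_ceil _
    rcases le_total n ⌈|t|⌉₊ with h | h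
    · exact (agree x _ _ h t ht).symm
    · refine agree x _ _ h t ⟨?_, ?_⟩
      · linarith [neg_abs_le t]
      · linarith [le_abs_self t]
  have hΦd : ∀ x t, HasDerivAt (Φ x) (v t (Φ x t)) t := by
    intro x t
    have h1 : |t| ≤ ⌈|t|⌉₊ := Nat.le_ceil _
    have ht : t ∈ Set.Ioo (-((⌈|t|⌉₊ : ℕ) + 1) : ℝ) ((⌈|t|⌉₊ : ℕ) + 1) :=
      ⟨by linarith [neg_abs_le t], by linarith [le_abs_self t]⟩
    refine (hα x ⌈|t|⌉₊ t ht).congr_of_eventuallyEq ?_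
    filter_upwards [Ioo_mem_nhds ht.1 ht.2] with u hu
    exact hΦ x _ u hu
  refine ⟨Φ, fun x => hα0 _ _, hΦd, fun t ht => ?_⟩
  have hΦ0 : ∀ x, Φ x 0 = x := fun x => hα0 _ _
  have : LipschitzWith (Real.toNNReal (Real.exp (K * t))) fun x => Φ x t := by
    refine LipschitzWith.of_dist_le_mul fun x y => ?_
    rw [Real.coe_toNNReal _ (Real.exp_pos _).le]
    have := dist_le_of_trajectories_ODE (v := v) (K := K) hv (a := 0) (b := t)
      (f := Φ x) (g := Φ y) (δ := dist x y)
      (fun u _ => (hΦd x u).continuousAt.continuousWithinAt)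
      (fun u _ => (hΦd x u).hasDerivWithinAt)
      (fun u _ => (hΦd y u).continuousAt.continuousWithinAt)
      (fun u _ => (hΦd y u).hasDerivWithinAt) (by rw [hΦ0, hΦ0]) t ⟨ht, le_rfl⟩
    rw [sub_zero] at this
    linarith
  exact this.continuous

/-- The inverse of the relativistic operator. -/
noncomputable def psi (c y : ℝ) : ℝ := y / Real.sqrt (1 + y ^ 2 / c ^ 2)

lemma psi_rad_pos (c y : ℝ) : 0 < 1 + y ^ 2 / c ^ 2 := by positivity

lemma psi_hasDerivAt (c y : ℝ) :
    HasDerivAt (psi c) (1 / ((1 + y ^ 2 / c ^ 2) * Real.sqrt (1 + y ^ 2 / c ^ 2))) y := by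
  have h0 := psi_rad_pos c y
  have h1 : HasDerivAt (fun y : ℝ => 1 + y ^ 2 / c ^ 2) (2 * y / c ^ 2) y := by
    have := ((hasDerivAt_pow 2 y).div_const (c ^ 2)).const_add 1
    simpa using this
  have h2 := (hasDerivAt_id y).div (h1.sqrt h0.ne') (Real.sqrt_pos.2 h0).ne'
  refine h2.congr_deriv ?_
  have hs := Real.sqrt_pos.2 h0
  have hsq := Real.sq_sqrt h0.le
  have hq : y * (2 * y / c ^ 2) = 2 * ((1 + y ^ 2 / c ^ 2) - 1) := by ring
  set s := Real.sqrt (1 + y ^ 2 / c ^ 2) with hsdef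
  rw [← hsq] at hq ⊢
  simp only [id]
  have : y * (2 * y / c ^ 2 / (2 * s)) = (s ^ 2 - 1) / s := by
    rw [show y * (2 * y / c ^ 2 / (2 * s)) = (y * (2 * y / c ^ 2)) / (2 * s) by ring, hq]
    field_simp
  rw [this]
  field_simp
  ring

lemma psi_deriv_pos (c y : ℝ) :
    0 < 1 / ((1 + y ^ 2 / c ^ 2) * Real.sqrt (1 + y ^ 2 / c ^ 2)) := by
  have := psi_rad_pos c y
  positivity

lemma psi_strictMono (c : ℝ) : StrictMono (psi c) :=
  strictMono_of_hasDerivAt_pos (psi_hasDerivAt c) (psi_deriv_pos c)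

lemma psi_zero (c : ℝ) : psi c 0 = 0 := by simp [psi]

lemma psi_continuous (c : ℝ) : Continuous (psi c) :=
  continuous_iff_continuousAt.2 fun y => (psi_hasDerivAt c y).continuousAt

lemma psi_lipschitz (c : ℝ) : LipschitzWith 1 (psi c) := by
  refine lipschitzWith_of_nnnorm_deriv_le (fun y => (psi_hasDerivAt c y).differentiableAt)
    fun y => ?_
  rw [(psi_hasDerivAt c y).deriv, ← NNReal.coe_le_coe, coe_nnnorm, Real.norm_eq_abs,
    abs_of_pos (psi_deriv_pos c y)]
  have h1 : 1 ≤ 1 + y ^ 2 / c ^ 2 := by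
    have : 0 ≤ y ^ 2 / c ^ 2 := by positivity
    linarith
  have h2 : 1 ≤ Real.sqrt (1 + y ^ 2 / c ^ 2) := Real.one_le_sqrt.2 h1
  rw [div_le_iff₀ (by positivity)]
  simp only [NNReal.coe_one, one_mul]
  nlinarith

lemma psi_abs_lt {c : ℝ} (hc : 0 < c) (y : ℝ) : |psi c y| < c := by
  have h0 := psi_rad_pos c y
  unfold psi
  rw [abs_div, abs_of_pos (Real.sqrt_pos.2 h0), div_lt_iff₀ (Real.sqrt_pos.2 h0)]
  apply lt_of_pow_lt_pow_left₀ 2 (by positivity)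
  rw [mul_pow, Real.sq_sqrt h0.le, sq_abs]
  have : c ^ 2 * (1 + y ^ 2 / c ^ 2) = c ^ 2 + y ^ 2 := by field_simp
  rw [this]
  nlinarith

lemma phi_psi {c : ℝ} (hc : 0 < c) (y : ℝ) : phi c (psi c y) = y := by
  have h0 := psi_rad_pos c y
  have hs := Real.sqrt_pos.2 h0
  have e : 1 - (psi c y) ^ 2 / c ^ 2 = (1 + y ^ 2 / c ^ 2)⁻¹ := by
    unfold psi
    rw [div_pow, Real.sq_sqrt h0.le]
    field_simp
    ring
  unfold phi
  rw [e, Real.sqrt_inv]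
  unfold psi
  field_simp

lemma psi_phi {c : ℝ} (hc : 0 < c) {v : ℝ} (hv : |v| < c) : psi c (phi c v) = v := by
  have h0 : 0 < 1 - v ^ 2 / c ^ 2 := by
    rw [sub_pos, div_lt_one (by positivity)]
    exact sq_lt_sq.2 (by rwa [abs_of_pos hc])
  have hs := Real.sqrt_pos.2 h0
  have h0' : c ^ 2 - v ^ 2 ≠ 0 := by
    intro h
    rw [show v ^ 2 = c ^ 2 by linarith, div_self (by positivity)] at h0
    simp at h0
  have e : 1 + (phi c v) ^ 2 / c ^ 2 = (1 - v ^ 2 / c ^ 2)⁻¹ := by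
    unfold phi
    rw [div_pow, Real.sq_sqrt h0.le]
    have := h0.ne'
    field_simp
    ring
  unfold psi
  rw [e, Real.sqrt_inv]
  unfold phi
  rw [div_inv_eq_mul, div_mul_cancel₀ _ hs.ne']

lemma per_deriv {x : ℝ → ℝ} {T : ℝ} (h : Function.Periodic x T) :
    Function.Periodic (deriv x) T := by
  intro t
  have : (fun t => x (t + T)) = x := funext h
  rw [← deriv_comp_add_const, this]

lemma pend_to_sys {c a b T : ℝ} (hc : 0 < c) {p x : ℝ → ℝ} (h : IsPendSol c a b T p x) :
    Function.Periodic x T ∧ ∃ y : ℝ → ℝ, Function.Periodic y T ∧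
      (∀ t, HasDerivAt x (psi c (y t)) t) ∧
      ∀ t, HasDerivAt y (p t - b * Real.sin (x t) - a * psi c (y t)) t := by
  obtain ⟨h1, h2, h3, h4, h5⟩ := h
  refine ⟨h1, fun t => phi c (deriv x t), fun t => ?_, fun t => ?_, fun t => ?_⟩
  · simp only [per_deriv h1 t]
  · rw [psi_phi hc (h3 t)]
    exact (h2.differentiable one_ne_zero t).hasDerivAt
  · rw [psi_phi hc (h3 t)]
    have := (h4.differentiable one_ne_zero t).hasDerivAt
    exact this.congr_deriv (by linarith [h5 t])

lemma sys_to_pend {c a b T : ℝ} (hc : 0 < c) {p x y : ℝ → ℝ} (hp : Continuous p)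
    (hx : Function.Periodic x T) (h1 : ∀ t, HasDerivAt x (psi c (y t)) t)
    (h2 : ∀ t, HasDerivAt y (p t - b * Real.sin (x t) - a * psi c (y t)) t) :
    IsPendSol c a b T p x := by
  have cx : Continuous x := continuous_iff_continuousAt.2 fun t => (h1 t).continuousAt
  have cy : Continuous y := continuous_iff_continuousAt.2 fun t => (h2 t).continuousAt
  have dx : deriv x = fun t => psi c (y t) := funext fun t => (h1 t).deriv
  have dy : deriv y = fun t => p t - b * Real.sin (x t) - a * psi c (y t) :=
    funext fun t => (h2 t).deriv
  have cψ := psi_continuous c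
  have e : (fun t => phi c (deriv x t)) = y := by
    funext t
    rw [dx, phi_psi hc]
  refine ⟨hx, ?_, ?_, ?_, ?_⟩
  · rw [contDiff_one_iff_deriv, dx]
    exact ⟨fun t => (h1 t).differentiableAt, by fun_prop⟩
  · intro t
    rw [dx]
    exact psi_abs_lt hc _
  · rw [e, contDiff_one_iff_deriv, dy]
    exact ⟨fun t => (h2 t).differentiableAt, by fun_prop⟩
  · intro t
    rw [e, dy, dx]
    ring

/-- Truncation to `[-S, S]`. -/
noncomputable def clip (S s : ℝ) : ℝ := max (-S) (min s S)

lemma clip_lip (S : ℝ) : LipschitzWith 1 (clip S) := by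
  have := (LipschitzWith.id (α := ℝ)).min_const S |>.const_max (-S)
  exact this

lemma clip_abs {S : ℝ} (hS : 0 ≤ S) (s : ℝ) : |clip S s| ≤ S :=
  abs_le.2 ⟨le_max_left _ _, max_le (by linarith) (min_le_right _ _)⟩

lemma clip_eq {S s : ℝ} (h : |s| ≤ S) : clip S s = s := by
  obtain ⟨h1, h2⟩ := abs_le.1 h
  unfold clip
  rw [min_eq_left h2, max_eq_right h1]

lemma sys_flow {c a T S B : ℝ} (hc : 0 < c) (ha : 0 < a) (hT : 0 < T) (hS : 0 ≤ S) (hB : 0 ≤ B)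
    (f : ℝ → ℝ → ℝ) (Kf : NNReal) (hfl : ∀ t, LipschitzWith Kf (f t))
    (hfc : ∀ x, Continuous fun t => f t x) (hfb : ∀ t x, |f t x| ≤ B)
    (hfp : ∀ t, f (t + T) = f t) :
    ∃ X Y : ℝ × ℝ × ℝ → ℝ → ℝ, (∀ z, X z 0 = z.1) ∧ (∀ z, Y z 0 = z.2.1) ∧
      (∀ z t, HasDerivAt (X z) (psi c (Y z t)) t) ∧
      (∀ z t, HasDerivAt (Y z) (f t (X z t) + clip S z.2.2 - a * psi c (Y z t)) t) ∧
      Continuous (fun z => X z T) ∧ Continuous (fun z => Y z T) ∧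
      (∀ z, X z T = z.1 → Y z T = z.2.1 →
        Function.Periodic (X z) T ∧ Function.Periodic (Y z) T) ∧
      (∀ (x y : ℝ → ℝ) (s : ℝ), |s| ≤ S → (∀ t, HasDerivAt x (psi c (y t)) t) →
        (∀ t, HasDerivAt y (f t (x t) + s - a * psi c (y t)) t) →
        X (x 0, y 0, s) T = x T ∧ Y (x 0, y 0, s) T = y T) := by
  let v : ℝ → ℝ × ℝ × ℝ → ℝ × ℝ × ℝ := fun t z =>
    (psi c z.2.1, f t z.1 + clip S z.2.2 - a * psi c z.2.1, 0)
  have hpl : LipschitzWith (1 * (1 * 1)) fun z : ℝ × ℝ × ℝ => psi c z.2.1 :=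
    (psi_lipschitz c).comp (LipschitzWith.prod_fst.comp LipschitzWith.prod_snd)
  obtain ⟨K, hK⟩ : ∃ K : NNReal, ∀ t, LipschitzWith K (v t) := by
    refine ⟨_, fun t => LipschitzWith.prodMk hpl (LipschitzWith.prodMk (LipschitzWith.sub
      (LipschitzWith.add ((hfl t).comp LipschitzWith.prod_fst)
        ((clip_lip S).comp (LipschitzWith.prod_snd.comp LipschitzWith.prod_snd)))
      ((lipschitzWith_smul a).comp hpl)) (LipschitzWith.const 0))⟩
  have hvc : ∀ z, Continuous fun t => v t z := fun z => by
    have := hfc z.1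
    fun_prop
  let L : NNReal := ⟨c + (B + S + a * c), by positivity⟩
  have hb : ∀ t z, ‖v t z‖ ≤ L := by
    intro t z
    have h1 := (psi_abs_lt hc z.2.1).le
    have h2 := hfb t z.1
    have h3 := clip_abs hS z.2.2
    have hac : 0 < a * c := by positivity
    have h4 : |f t z.1 + clip S z.2.2 - a * psi c z.2.1| ≤ B + S + a * c := by
      have h5 : |a * psi c z.2.1| ≤ a * c := by
        rw [abs_mul, abs_of_pos ha]; exact mul_le_mul_of_nonneg_left h1 ha.le
      rw [abs_le] at *
      constructor <;> linarith [h2.1, h2.2, h3.1, h3.2, h5.1, h5.2]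
    have hL : (L : ℝ) = c + (B + S + a * c) := rfl
    rw [hL]
    simp only [v]
    refine norm_prod_le_iff.2 ⟨?_, norm_prod_le_iff.2 ⟨?_, ?_⟩⟩
    · rw [Real.norm_eq_abs]; simp only; linarith
    · rw [Real.norm_eq_abs]; simp only; linarith
    · simp only [norm_zero]; positivity
  obtain ⟨Φ, h0, hd, hcont⟩ := global_flow v K L hK hvc hb
  have d1 : ∀ z t, HasDerivAt (fun t => (Φ z t).1) (psi c (Φ z t).2.1) t := fun z t =>
    ((ContinuousLinearMap.fst ℝ ℝ (ℝ × ℝ)).hasFDerivAt.comp_hasDerivAt t (hd z t))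
  have d2 : ∀ z t, HasDerivAt (fun t => (Φ z t).2.1)
      (f t (Φ z t).1 + clip S (Φ z t).2.2 - a * psi c (Φ z t).2.1) t := fun z t =>
    (((ContinuousLinearMap.fst ℝ ℝ ℝ).comp
      (ContinuousLinearMap.snd ℝ ℝ (ℝ × ℝ))).hasFDerivAt.comp_hasDerivAt t (hd z t))
  have d3 : ∀ z t, HasDerivAt (fun t => (Φ z t).2.2) 0 t := fun z t =>
    (((ContinuousLinearMap.snd ℝ ℝ ℝ).comp
      (ContinuousLinearMap.snd ℝ ℝ (ℝ × ℝ))).hasFDerivAt.comp_hasDerivAt t (hd z t))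
  have e3 : ∀ z t, (Φ z t).2.2 = z.2.2 := fun z t => by
    have := is_const_of_deriv_eq_zero (fun t => (d3 z t).differentiableAt)
      (fun t => (d3 z t).deriv) t 0
    simp only [h0] at this
    exact this
  have uniq : ∀ P Q : ℝ → ℝ × ℝ × ℝ, (∀ t, HasDerivAt P (v t (P t)) t) →
      (∀ t, HasDerivAt Q (v t (Q t)) t) → P 0 = Q 0 → P = Q := fun P Q hP hQ h =>
    ODE_solution_unique_univ (v := v) (K := K) (s := fun _ => Set.univ) (t₀ := 0)
      (fun t => (hK t).lipschitzOnWith) (fun t => ⟨hP t, trivial⟩) (fun t => ⟨hQ t, trivial⟩) h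
  refine ⟨fun z t => (Φ z t).1, fun z t => (Φ z t).2.1, fun z => by simp [h0],
    fun z => by simp [h0], d1, ?_, continuous_fst.comp (hcont T hT.le),
    continuous_fst.comp (continuous_snd.comp (hcont T hT.le)), ?_, ?_⟩
  · intro z t
    have := d2 z t
    rwa [e3] at this
  · intro z hx hy
    have hz : Φ z T = z := Prod.ext hx (Prod.ext hy (e3 z T))
    have : (fun t => Φ z (t + T)) = Φ z := by
      refine uniq _ _ (fun t => ?_) (hd z) (by simp [hz, h0])
      have h1 := (hd z (t + T)).comp_add_const t T
      refine h1.congr_deriv ?_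
      simp only [v, hfp]
    exact ⟨fun t => congrArg Prod.fst (congrFun this t),
      fun t => congrArg (fun q : ℝ × ℝ × ℝ => q.2.1) (congrFun this t)⟩
  · intro x y s hs h1 h2
    have : Φ (x 0, y 0, s) = fun t => (x t, y t, s) := by
      refine uniq _ _ (hd _) (fun t => ?_) (h0 _)
      have := (h1 t).prodMk ((h2 t).prodMk (hasDerivAt_const t s))
      refine this.congr_deriv ?_
      simp only [v, clip_eq hs]
    simp [this]

lemma per_bdd {x : ℝ → ℝ} {T : ℝ} (hT : 0 < T) (hx : Continuous x) (hp : Function.Periodic x T) :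
    ∃ C, 0 ≤ C ∧ ∀ t, |x t| ≤ C := by
  obtain ⟨C, hC⟩ := isCompact_Icc.exists_bound_of_continuousOn (s := Set.Icc 0 T) hx.continuousOn
  refine ⟨C, (norm_nonneg _).trans (hC 0 ⟨le_rfl, hT.le⟩), fun t => ?_⟩
  obtain ⟨u, hu, e⟩ := hp.exists_mem_Ico₀ hT t
  rw [e]
  exact hC u (Set.Ico_subset_Icc_self hu)

lemma lin_bound {x d : ℝ → ℝ} {C : ℝ} (h : ∀ t, HasDerivAt x (d t) t) (hd : ∀ t, |d t| ≤ C)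
    (t : ℝ) (ht : 0 ≤ t) : |x t - x 0| ≤ C * t := by
  have := Convex.norm_image_sub_le_of_norm_hasDerivWithin_le (s := Set.univ)
    (fun t _ => (h t).hasDerivWithinAt) (fun t _ => hd t) convex_univ (Set.mem_univ 0)
    (Set.mem_univ t)
  simpa [abs_of_nonneg ht] using this

lemma strict_lt {W d : ℝ → ℝ} {p q : ℝ} (hpq : p < q) (h : ∀ t, HasDerivAt W (d t) t)
    (hd : ∀ t ∈ Set.Ioo p q, 0 < d t) : W p < W q := by
  have hm : StrictMonoOn W (Set.Icc p q) := by
    refine strictMonoOn_of_deriv_pos (convex_Icc p q)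
      (fun t _ => (h t).continuousAt.continuousWithinAt) fun t ht => ?_
    rw [interior_Icc] at ht
    rw [(h t).deriv]
    exact hd t ht
  exact hm ⟨le_rfl, hpq.le⟩ ⟨hpq.le, le_rfl⟩ hpq

section estimates

lemma energy_deriv {c a : ℝ} {x y h p₀ : ℝ → ℝ} (hp : Continuous p₀)
    (h1 : ∀ t, HasDerivAt x (psi c (y t)) t)
    (h2 : ∀ t, HasDerivAt y (h t - a * psi c (y t)) t) (t : ℝ) :
    HasDerivAt (fun t => y t + a * x t - ∫ u in (0 : ℝ)..t, p₀ u) (h t - p₀ t) t := by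
  have h3 : HasDerivAt (fun t => ∫ u in (0 : ℝ)..t, p₀ u) (p₀ t) t :=
    intervalIntegral.integral_hasDerivAt_right (hp.intervalIntegrable _ _)
      (hp.stronglyMeasurableAtFilter _ _) hp.continuousAt
  exact (((h2 t).add ((h1 t).const_mul a)).sub h3).congr_deriv (by ring)

lemma energy_lt {c a T : ℝ} (hT : 0 < T) {x y h p₀ : ℝ → ℝ} (hp : Continuous p₀)
    (hp0 : (∫ t in (0 : ℝ)..T, p₀ t) = 0)
    (h1 : ∀ t, HasDerivAt x (psi c (y t)) t)
    (h2 : ∀ t, HasDerivAt y (h t - a * psi c (y t)) t)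
    (hh : ∀ t ∈ Set.Icc 0 T, p₀ t < h t) : y 0 + a * x 0 < y T + a * x T := by
  have := strict_lt hT (energy_deriv hp h1 h2)
    (fun t ht => by linarith [hh t (Set.Ioo_subset_Icc_self ht)])
  simp only [intervalIntegral.integral_same, hp0] at this
  linarith

lemma energy_gt {c a T : ℝ} (hT : 0 < T) {x y h p₀ : ℝ → ℝ} (hp : Continuous p₀)
    (hp0 : (∫ t in (0 : ℝ)..T, p₀ t) = 0)
    (h1 : ∀ t, HasDerivAt x (psi c (y t)) t)
    (h2 : ∀ t, HasDerivAt y (h t - a * psi c (y t)) t)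
    (hh : ∀ t ∈ Set.Icc 0 T, h t < p₀ t) : y T + a * x T < y 0 + a * x 0 := by
  have := strict_lt hT (fun t => (energy_deriv hp h1 h2 t).neg)
    (fun t ht => by linarith [hh t (Set.Ioo_subset_Icc_self ht)])
  simp only [Pi.neg_apply, intervalIntegral.integral_same, hp0] at this
  linarith

lemma drift_lt {c T C : ℝ} (hT : 0 < T) {x y d : ℝ → ℝ} (hC : 0 ≤ C)
    (h1 : ∀ t, HasDerivAt x (psi c (y t)) t) (h2 : ∀ t, HasDerivAt y (d t) t)
    (hd : ∀ t, |d t| ≤ C) (h0 : C * T < y 0) : x 0 < x T := by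
  refine strict_lt hT h1 fun t ht => ?_
  rw [← psi_zero c]
  apply psi_strictMono c
  have := (abs_le.1 (lin_bound h2 hd t ht.1.le)).1
  have : C * t ≤ C * T := mul_le_mul_of_nonneg_left ht.2.le hC
  linarith

lemma drift_gt {c T C : ℝ} (hT : 0 < T) {x y d : ℝ → ℝ} (hC : 0 ≤ C)
    (h1 : ∀ t, HasDerivAt x (psi c (y t)) t) (h2 : ∀ t, HasDerivAt y (d t) t)
    (hd : ∀ t, |d t| ≤ C) (h0 : y 0 < -(C * T)) : x T < x 0 := by
  have := strict_lt hT (fun t => (h1 t).neg) fun t ht => ?_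
  · simp only [Pi.neg_apply] at this
    linarith
  · rw [neg_pos, ← psi_zero c]
    apply psi_strictMono c
    have := (abs_le.1 (lin_bound h2 hd t ht.1.le)).2
    have : C * t ≤ C * T := mul_le_mul_of_nonneg_left ht.2.le hC
    linarith

lemma comparison {c a T : ℝ} (hT : 0 < T) {x y h β w k : ℝ → ℝ}
    (hx : Function.Periodic x T) (hβ : Function.Periodic β T)
    (h1 : ∀ t, HasDerivAt x (psi c (y t)) t)
    (h2 : ∀ t, HasDerivAt y (h t - a * psi c (y t)) t)
    (h3 : ∀ t, HasDerivAt β (psi c (w t)) t)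
    (h4 : ∀ t, HasDerivAt w (k t - a * psi c (w t)) t)
    (hk : ∀ t, β t < x t → k t < h t) : ∀ t, x t ≤ β t := by
  have hd : ∀ t, HasDerivAt (fun t => x t - β t) (psi c (y t) - psi c (w t)) t :=
    fun t => (h1 t).sub (h3 t)
  have hcd : Continuous fun t => x t - β t :=
    continuous_iff_continuousAt.2 fun t => (hd t).continuousAt
  obtain ⟨t₀, -, ht₀⟩ := isCompact_Icc.exists_isMaxOn (s := Set.Icc 0 T)
    ⟨0, le_rfl, hT.le⟩ hcd.continuousOn
  have hmax : ∀ t, x t - β t ≤ x t₀ - β t₀ := by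
    intro t
    have hper : Function.Periodic (fun t => x t - β t) T := fun t => by
      simp only [hx t, hβ t]
    obtain ⟨u, hu, e⟩ := hper.exists_mem_Ico₀ hT t
    refine e.trans_le ?_
    exact ht₀ (Set.Ico_subset_Icc_self hu)
  by_contra hcon
  push Not at hcon
  obtain ⟨t₁, ht₁⟩ := hcon
  have hpos : β t₀ < x t₀ := by linarith [hmax t₁]
  have hz : psi c (y t₀) - psi c (w t₀) = 0 :=
    IsLocalMax.hasDerivAt_eq_zero (Filter.Eventually.of_forall hmax) (hd t₀)
  have hyw : y t₀ = w t₀ := (psi_strictMono c).injective (by linarith)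
  have hu : HasDerivAt (fun t => y t - w t) (h t₀ - k t₀) t₀ :=
    ((h2 t₀).sub (h4 t₀)).congr_deriv (by rw [hyw]; ring)
  have hev : ∀ᶠ t in nhdsWithin t₀ (Set.Ioi t₀), w t < y t := by
    have hsub : Set.Ioi t₀ ⊆ {t₀}ᶜ := fun t (ht : t₀ < t) => ht.ne'
    have hs := (hasDerivAt_iff_tendsto_slope.1 hu).mono_left (nhdsWithin_mono t₀ hsub)
    filter_upwards [hs.eventually (lt_mem_nhds (by linarith [hk t₀ hpos] : 0 < h t₀ - k t₀)),
      self_mem_nhdsWithin] with t ht1 ht2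
    have ht2' : 0 < t - t₀ := sub_pos.2 ht2
    rw [slope_def_field, div_pos_iff_of_pos_right ht2'] at ht1
    linarith
  obtain ⟨r, hr, hr'⟩ := (mem_nhdsGT_iff_exists_Ioo_subset).1 hev
  have := strict_lt (Set.mem_Ioi.1 hr) hd fun t ht => sub_pos.2 (psi_strictMono c (hr' ht))
  linarith [hmax r]

end estimates

/-- The truncated periodic problem always has a periodic solution: a common existence lemma. -/
lemma exists_periodic {c a T s B R : ℝ} (hc : 0 < c) (ha : 0 < a) (hT : 0 < T) (hB : 0 ≤ B)
    {p₀ : ℝ → ℝ} (hp : Continuous p₀) (hp0 : (∫ t in (0 : ℝ)..T, p₀ t) = 0)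
    (f : ℝ → ℝ → ℝ) (Kf : NNReal) (hfl : ∀ t, LipschitzWith Kf (f t))
    (hfc : ∀ x, Continuous fun t => f t x) (hfb : ∀ t x, |f t x| ≤ B)
    (hfp : ∀ t, f (t + T) = f t) (hR : 0 ≤ R)
    (hup : ∀ t x, R ≤ x → p₀ t < f t x + s) (hdn : ∀ t x, x ≤ -R → f t x + s < p₀ t) :
    ∃ x y : ℝ → ℝ, Function.Periodic x T ∧ Function.Periodic y T ∧
      (∀ t, HasDerivAt x (psi c (y t)) t) ∧
      (∀ t, HasDerivAt y (f t (x t) + s - a * psi c (y t)) t) := by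
  obtain ⟨X, Y, hX0, hY0, hX, hY, cX, cY, hper, -⟩ := sys_flow (S := |s|) hc ha hT (abs_nonneg s) hB f Kf
    hfl hfc hfb hfp
  let C := B + |s| + a * c
  have hC : 0 ≤ C := by positivity
  have hbd : ∀ z t, |f t (X z t) + clip |s| z.2.2 - a * psi c (Y z t)| ≤ C := by
    intro z t
    have h1 := (psi_abs_lt hc (Y z t)).le
    have h2 := hfb t (X z t)
    have h3 := clip_abs (abs_nonneg s) z.2.2
    have h5 : |a * psi c (Y z t)| ≤ a * c := by
      rw [abs_mul, abs_of_pos ha]; exact mul_le_mul_of_nonneg_left h1 ha.le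
    calc _ ≤ |f t (X z t)| + |clip |s| z.2.2| + |a * psi c (Y z t)| := by
          refine (abs_sub _ _).trans ?_
          gcongr
          exact abs_add_le _ _
      _ ≤ C := by simp only [C]; linarith
  have hXb : ∀ z t, 0 ≤ t → t ≤ T → |X z t - z.1| ≤ c * T := by
    intro z t ht ht'
    have := lin_bound (hX z) (fun t => (psi_abs_lt hc (Y z t)).le) t ht
    rw [hX0] at this
    have h6 : c * t ≤ c * T := mul_le_mul_of_nonneg_left ht' hc.le
    linarith
  have hs : clip |s| s = s := clip_eq le_rfl
  have hcT : 0 < c * T := by positivity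
  have hCT : 0 ≤ C * T := by positivity
  obtain ⟨u, -, w, -, e1, e2⟩ := poincare_miranda
    (fun z => Y (z.1, z.2, s) T + a * X (z.1, z.2, s) T - (z.2 + a * z.1))
    (fun z => X (z.1, z.2, s) T - z.1)
    (by fun_prop) (by fun_prop) (R + c * T) (C * T + 1) (by linarith) (by linarith)
    (by
      intro v _
      have := energy_lt (h := fun t => f t (X (R + c * T, v, s) t) + clip |s| s) hT hp hp0
        (hX (R + c * T, v, s)) (hY (R + c * T, v, s)) (by
          intro t ht
          rw [hs]
          have h7 := abs_le.1 (hXb (R + c * T, v, s) t ht.1 ht.2)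
          exact hup t _ (by linarith [h7.1]))
      rw [hX0, hY0] at this
      simp only at this ⊢
      linarith)
    (by
      intro v _
      have := energy_gt (h := fun t => f t (X (-(R + c * T), v, s) t) + clip |s| s) hT hp hp0
        (hX (-(R + c * T), v, s)) (hY (-(R + c * T), v, s)) (by
          intro t ht
          rw [hs]
          have h7 := abs_le.1 (hXb (-(R + c * T), v, s) t ht.1 ht.2)
          exact hdn t _ (by linarith [h7.2]))
      rw [hX0, hY0] at this
      simp only at this ⊢
      linarith)
    (by
      intro u _
      have := drift_lt hT hC (hX (u, C * T + 1, s)) (hY (u, C * T + 1, s)) (hbd _)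
        (by rw [hY0]; simp)
      rw [hX0] at this
      simp only at this ⊢
      linarith)
    (by
      intro u _
      have := drift_gt hT hC (hX (u, -(C * T + 1), s)) (hY (u, -(C * T + 1), s)) (hbd _)
        (by rw [hY0]; simp)
      rw [hX0] at this
      simp only at this ⊢
      linarith)
  simp only at e1 e2
  obtain ⟨p1, p2⟩ := hper (u, w, s) (by simp only; linarith) (by
    simp only
    have : X (u, w, s) T = u := by linarith
    rw [this] at e1
    linarith)
  refine ⟨X (u, w, s), Y (u, w, s), p1, p2, hX _, fun t => ?_⟩
  have := hY (u, w, s) t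
  simpa only [hs] using this

section main

variable {c a b T : ℝ} {p₀ : ℝ → ℝ}

lemma mem_solvSet_iff (hc : 0 < c) (hp : Continuous p₀) (s : ℝ) :
    s ∈ solvSet c a b T p₀ ↔ ∃ x y : ℝ → ℝ, Function.Periodic x T ∧ Function.Periodic y T ∧
      (∀ t, HasDerivAt x (psi c (y t)) t) ∧
      (∀ t, HasDerivAt y (p₀ t + -b * Real.sin (x t) + s - a * psi c (y t)) t) := by
  constructor
  · rintro ⟨x, hx⟩
    obtain ⟨h1, y, h2, h3, h4⟩ := pend_to_sys hc hx
    exact ⟨x, y, h1, h2, h3, fun t => (h4 t).congr_deriv (by ring)⟩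
  · rintro ⟨x, y, h1, -, h3, h4⟩
    exact ⟨x, sys_to_pend (y := y) hc (by fun_prop) h1 h3 fun t => (h4 t).congr_deriv (by ring)⟩

lemma sin_bd (hb : 0 < b) (θ : ℝ) : -b ≤ b * Real.sin θ ∧ b * Real.sin θ ≤ b :=
  ⟨by nlinarith [Real.neg_one_le_sin θ], by nlinarith [Real.sin_le_one θ]⟩

lemma solvSet_bdd (hc : 0 < c) (hb : 0 < b) (hT : 0 < T) (hp : Continuous p₀)
    (hp0 : (∫ t in (0:ℝ)..T, p₀ t) = 0) {s : ℝ} (hs : s ∈ solvSet c a b T p₀) : |s| ≤ b := by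
  obtain ⟨x, y, h1, h2, h3, h4⟩ := (mem_solvSet_iff hc hp s).1 hs
  have ex : x T = x 0 := by simpa using h1 0
  have ey : y T = y 0 := by simpa using h2 0
  rw [abs_le]
  constructor
  · by_contra hcon
    push Not at hcon
    have := energy_gt (h := fun t => p₀ t + -b * Real.sin (x t) + s) hT hp hp0 h3 h4
      fun t _ => by linarith [(sin_bd hb (x t)).1]
    rw [ex, ey] at this
    exact lt_irrefl _ this
  · by_contra hcon
    push Not at hcon
    have := energy_lt (h := fun t => p₀ t + -b * Real.sin (x t) + s) hT hp hp0 h3 h4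
      fun t _ => by linarith [(sin_bd hb (x t)).2]
    rw [ex, ey] at this
    exact lt_irrefl _ this

lemma base_lip (b : ℝ) : ∃ K : NNReal, ∀ q : ℝ, LipschitzWith K fun x => q + -b * Real.sin x :=
  ⟨_, fun q => (LipschitzWith.const q).add ((lipschitzWith_smul (-b)).comp Real.lipschitzWith_sin)⟩

lemma solvSet_nonempty (hc : 0 < c) (ha : 0 < a) (hb : 0 < b) (hT : 0 < T)
    (hp : Continuous p₀) (hper : Function.Periodic p₀ T)
    (hp0 : (∫ t in (0:ℝ)..T, p₀ t) = 0) :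
    (solvSet c a b T p₀).Nonempty ∧ IsCompact (solvSet c a b T p₀) := by
  obtain ⟨P, hP0, hP⟩ := per_bdd hT hp hper
  obtain ⟨K, hK⟩ := base_lip b
  have hfb : ∀ t x, |p₀ t + -b * Real.sin x| ≤ P + b := fun t x => by
    have h1 := abs_le.1 (hP t)
    have h2 := sin_bd hb x
    rw [abs_le]
    constructor <;> linarith [h1.1, h1.2, h2.1, h2.2]
  obtain ⟨X, Y, hX0, hY0, hX, hY, cX, cY, hpr, huniq⟩ := sys_flow (S := b + 1) (B := P + b)
    hc ha hT (by linarith) (by linarith) (fun t x => p₀ t + -b * Real.sin x) K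
    (fun t => hK (p₀ t)) (fun x => by fun_prop) hfb (fun t => by funext x; rw [hper])
  let C := P + b + (b + 1) + a * c
  have hC : 0 ≤ C := by positivity
  have hCT : 0 ≤ C * T := by positivity
  have hbd : ∀ x y σ t, |σ| ≤ b + 1 → |p₀ t + -b * Real.sin x + σ - a * psi c y| ≤ C := by
    intro x y σ t hσ
    have h1 := (psi_abs_lt hc y).le
    have h2 := abs_le.1 (hfb t x)
    have h3 := abs_le.1 hσ
    have h5 : |a * psi c y| ≤ a * c := by
      rw [abs_mul, abs_of_pos ha]; exact mul_le_mul_of_nonneg_left h1 ha.le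
    have h6 := abs_le.1 h5
    rw [abs_le]
    simp only [C]
    constructor <;> linarith [h2.1, h2.2, h3.1, h3.2, h6.1, h6.2]
  have hcl := clip_abs (S := b + 1) (by linarith)
  have key : ∀ z : ℝ × ℝ × ℝ, |z.2.2| ≤ b + 1 → X z T = z.1 → Y z T = z.2.1 →
      z.2.2 ∈ solvSet c a b T p₀ := by
    intro z hz e1 e2
    obtain ⟨p1, p2⟩ := hpr z e1 e2
    refine (mem_solvSet_iff hc hp _).2 ⟨X z, Y z, p1, p2, hX z, fun t => ?_⟩
    have := hY z t
    rwa [clip_eq hz] at this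
  constructor
  · obtain ⟨s, hs, w, -, e1, e2⟩ := poincare_miranda
      (fun z => Y (0, z.2, z.1) T + a * X (0, z.2, z.1) T - z.2)
      (fun z => X (0, z.2, z.1) T)
      (by fun_prop) (by fun_prop) (b + 1) (C * T + 1) (by linarith) (by linarith)
      (by
        intro v _
        have hq : clip (b + 1) (b + 1) = b + 1 := clip_eq (by rw [abs_of_pos (by linarith)])
        have := energy_lt (h := fun t => p₀ t + -b * Real.sin (X (0, v, b + 1) t) +
          clip (b + 1) (b + 1)) hT hp hp0 (hX (0, v, b + 1)) (hY (0, v, b + 1))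
          (fun t _ => by rw [hq]; linarith [(sin_bd hb (X (0, v, b + 1) t)).2])
        rw [hX0, hY0] at this
        simp only at this ⊢
        linarith)
      (by
        intro v _
        have hq : clip (b + 1) (-(b + 1)) = -(b + 1) :=
          clip_eq (by rw [abs_neg, abs_of_pos (by linarith)])
        have := energy_gt (h := fun t => p₀ t + -b * Real.sin (X (0, v, -(b + 1)) t) +
          clip (b + 1) (-(b + 1))) hT hp hp0 (hX (0, v, -(b + 1))) (hY (0, v, -(b + 1)))
          (fun t _ => by rw [hq]; linarith [(sin_bd hb (X (0, v, -(b + 1)) t)).1])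
        rw [hX0, hY0] at this
        simp only at this ⊢
        linarith)
      (by
        intro u _
        have := drift_lt hT hC (hX (0, C * T + 1, u)) (hY (0, C * T + 1, u))
          (fun t => hbd _ _ _ _ (hcl _)) (by rw [hY0]; simp)
        rw [hX0] at this
        exact this)
      (by
        intro u _
        have := drift_gt hT hC (hX (0, -(C * T + 1), u)) (hY (0, -(C * T + 1), u))
          (fun t => hbd _ _ _ _ (hcl _)) (by rw [hY0]; simp)
        rw [hX0] at this
        exact this)
    simp only at e1 e2
    refine ⟨s, key (0, w, s) (abs_le.2 hs) e2 ?_⟩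
    rw [e2] at e1
    simp only
    linarith
  · let Z : Set (ℝ × ℝ × ℝ) := (Set.Icc 0 (2 * Real.pi) ×ˢ Set.Icc (-(C * T)) (C * T) ×ˢ
      Set.Icc (-b) b) ∩ {z | X z T = z.1 ∧ Y z T = z.2.1}
    have hZ : IsCompact Z := by
      refine (isCompact_Icc.prod (isCompact_Icc.prod isCompact_Icc)).inter_right ?_
      exact (isClosed_eq cX continuous_fst).inter (isClosed_eq cY (by fun_prop))
    have : solvSet c a b T p₀ = (fun z : ℝ × ℝ × ℝ => z.2.2) '' Z := by
      ext s
      constructor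
      · intro hs
        have hsb := solvSet_bdd hc hb hT hp hp0 hs
        obtain ⟨x, y, h1, h2, h3, h4⟩ := (mem_solvSet_iff hc hp s).1 hs
        have hsb1 : |s| ≤ b + 1 := by linarith
        let n : ℤ := ⌊x 0 / (2 * Real.pi)⌋
        have hsin : ∀ t, Real.sin (x t - n * (2 * Real.pi)) = Real.sin (x t) :=
          fun t => Real.sin_sub_int_mul_two_pi _ _
        obtain ⟨u1, u2⟩ := huniq (fun t => x t - n * (2 * Real.pi)) y s hsb1
          (fun t => (h3 t).sub_const _) (fun t => by simp only [hsin]; exact h4 t)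
        have ex : x T = x 0 := by simpa using h1 0
        have ey : y T = y 0 := by simpa using h2 0
        refine ⟨(x 0 - n * (2 * Real.pi), y 0, s), ⟨⟨⟨?_, ?_⟩, ⟨?_, ?_⟩, abs_le.1 hsb⟩, ?_, ?_⟩, rfl⟩
        · have := Int.floor_le (x 0 / (2 * Real.pi))
          rw [le_div_iff₀ (by positivity)] at this
          simp only [n]
          linarith
        · have := (Int.lt_floor_add_one (x 0 / (2 * Real.pi))).le
          rw [div_le_iff₀ (by positivity)] at this
          simp only [n]
          linarith
        · by_contra hcon
          simp only [not_le] at hcon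
          have := drift_gt hT hC h3 h4 (fun t => hbd _ _ _ _ hsb1) hcon
          linarith
        · by_contra hcon
          simp only [not_le] at hcon
          have := drift_lt hT hC h3 h4 (fun t => hbd _ _ _ _ hsb1) hcon
          linarith
        · simp only [ex] at u1
          exact u1
        · simp only [ey] at u2
          exact u2
      · rintro ⟨z, ⟨⟨-, -, hz⟩, e1, e2⟩, rfl⟩
        exact key z (by have := abs_le.2 hz; linarith) e1 e2
    rw [this]
    exact hZ.image (by fun_prop)

lemma trunc_lip (b : ℝ) : ∃ K : NNReal, ∀ q A B : ℝ, LipschitzWith K fun x =>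
    q + -b * Real.sin (max A (min x B)) + 3 * b * clip 1 (x - max A (min x B)) := by
  have hm : ∀ A B : ℝ, LipschitzWith 1 fun x : ℝ => max A (min x B) := fun A B =>
    ((LipschitzWith.id (α := ℝ)).min_const B).const_max A
  exact ⟨_, fun q A B => ((LipschitzWith.const q).add
    ((lipschitzWith_smul (-b)).comp (Real.lipschitzWith_sin.comp (hm A B)))).add
    ((lipschitzWith_smul (3 * b)).comp ((clip_lip 1).comp ((LipschitzWith.id).sub (hm A B))))⟩

lemma solvSet_ordConnected (hc : 0 < c) (ha : 0 < a) (hb : 0 < b) (hT : 0 < T)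
    (hp : Continuous p₀) (hper : Function.Periodic p₀ T)
    (hp0 : (∫ t in (0:ℝ)..T, p₀ t) = 0) : (solvSet c a b T p₀).OrdConnected := by
  refine ⟨fun s₁ hs₁ s₂ hs₂ s hs => ?_⟩
  have hb1 := abs_le.1 (solvSet_bdd hc hb hT hp hp0 hs₁)
  have hb2 := abs_le.1 (solvSet_bdd hc hb hT hp hp0 hs₂)
  obtain ⟨P, hP0, hP⟩ := per_bdd hT hp hper
  obtain ⟨β, w, pβ, pw, dβ, dw⟩ := (mem_solvSet_iff hc hp s₁).1 hs₁
  obtain ⟨x₂, k, px₂, pk, dx₂, dk⟩ := (mem_solvSet_iff hc hp s₂).1 hs₂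
  have cβ : Continuous β := continuous_iff_continuousAt.2 fun t => (dβ t).continuousAt
  have cx₂ : Continuous x₂ := continuous_iff_continuousAt.2 fun t => (dx₂ t).continuousAt
  obtain ⟨C₁, hC₁, bβ⟩ := per_bdd hT cβ pβ
  obtain ⟨C₂, hC₂, bx₂⟩ := per_bdd hT cx₂ px₂
  obtain ⟨n, hn⟩ := exists_nat_gt (C₁ + C₂)
  have hn0 : (0 : ℝ) ≤ n := Nat.cast_nonneg n
  obtain ⟨α, hα⟩ : ∃ α : ℝ → ℝ, α = fun t => x₂ t - n * (2 * Real.pi) := ⟨_, rfl⟩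
  have pα : Function.Periodic α T := fun t => by simp only [hα, px₂ t]
  have cα : Continuous α := by rw [hα]; fun_prop
  have dα : ∀ t, HasDerivAt α (psi c (k t)) t := fun t => by
    rw [hα]; exact (dx₂ t).sub_const _
  have dk' : ∀ t, HasDerivAt k (p₀ t + -b * Real.sin (α t) + s₂ - a * psi c (k t)) t := fun t => by
    rw [hα]
    simp only [Real.sin_sub_nat_mul_two_pi]
    exact dk t
  have hαβ : ∀ t, α t ≤ β t := fun t => by
    have h1 := abs_le.1 (bβ t)
    have h2 := abs_le.1 (bx₂ t)
    have h3 : (n : ℝ) * 1 ≤ n * (2 * Real.pi) :=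
      mul_le_mul_of_nonneg_left (by linarith [Real.pi_gt_three]) hn0
    simp only [hα]
    linarith [h1.1, h2.2]
  obtain ⟨C₃, hC₃, bα⟩ := per_bdd hT cα pα
  obtain ⟨K, hK⟩ := trunc_lip b
  have clip_one : ∀ z : ℝ, 1 ≤ z → clip 1 z = 1 := fun z hz => by
    unfold clip; rw [min_eq_right hz]; norm_num
  have clip_neg_one : ∀ z : ℝ, z ≤ -1 → clip 1 z = -1 := fun z hz => by
    unfold clip; rw [min_eq_left (by linarith), max_eq_left hz]
  have clip_pos : ∀ z : ℝ, 0 < z → 0 < clip 1 z := fun z hz =>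
    lt_max_of_lt_right (lt_min hz one_pos)
  have clip_neg : ∀ z : ℝ, z < 0 → clip 1 z < 0 := fun z hz =>
    max_lt (by norm_num) (min_lt_of_left_lt hz)
  have g_up : ∀ t x, β t ≤ x → max (α t) (min x (β t)) = β t := fun t x h => by
    rw [min_eq_right h, max_eq_right (hαβ t)]
  have g_dn : ∀ t x, x ≤ α t → max (α t) (min x (β t)) = α t := fun t x h => by
    rw [min_eq_left (h.trans (hαβ t)), max_eq_left h]
  have cclip : Continuous (clip 1) := (clip_lip 1).continuous
  obtain ⟨x, y, px, py, dx, dy⟩ := exists_periodic (s := s) (B := P + b + 3 * b) (R := C₁ + C₃ + 1)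
    hc ha hT (by linarith) hp hp0
    (fun t x => p₀ t + -b * Real.sin (max (α t) (min x (β t))) +
      3 * b * clip 1 (x - max (α t) (min x (β t)))) K (fun t => hK _ _ _)
    (fun x => by fun_prop)
    (fun t x => by
      have h1 := abs_le.1 (hP t)
      have h2 := sin_bd hb (max (α t) (min x (β t)))
      have h3 := abs_le.1 (clip_abs zero_le_one (x - max (α t) (min x (β t))))
      rw [abs_le]
      constructor <;> nlinarith [h1.1, h1.2, h2.1, h2.2, h3.1, h3.2])
    (fun t => by funext x; rw [hper, pα, pβ])
    (by linarith)
    (fun t x hx => by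
      have h1 := abs_le.1 (bβ t)
      have h2 := sin_bd hb (β t)
      rw [g_up t x (by linarith [h1.2]), clip_one _ (by linarith [h1.2])]
      linarith [h2.2, hs.1, hb1.1])
    (fun t x hx => by
      have h1 := abs_le.1 (bα t)
      have h2 := sin_bd hb (α t)
      rw [g_dn t x (by linarith [h1.1]), clip_neg_one _ (by linarith [h1.1])]
      linarith [h2.1, hs.2, hb2.2])
  have le_β : ∀ t, x t ≤ β t := comparison (h := fun t => p₀ t +
      -b * Real.sin (max (α t) (min (x t) (β t))) +
      3 * b * clip 1 (x t - max (α t) (min (x t) (β t))) + s)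
    (k := fun t => p₀ t + -b * Real.sin (β t) + s₁) hT px pβ dx dy dβ dw (fun t ht => by
      rw [g_up t _ ht.le]
      have : 0 < 3 * b * clip 1 (x t - β t) := mul_pos (by linarith) (clip_pos _ (by linarith))
      linarith [hs.1])
  have ge_α : ∀ t, α t ≤ x t := comparison (k := fun t => p₀ t +
      -b * Real.sin (max (α t) (min (x t) (β t))) +
      3 * b * clip 1 (x t - max (α t) (min (x t) (β t))) + s)
    (h := fun t => p₀ t + -b * Real.sin (α t) + s₂) hT pα px dα dk' dx dy (fun t ht => by
      rw [g_dn t _ ht.le]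
      have : 0 < 3 * b * -clip 1 (x t - α t) :=
        mul_pos (by linarith) (neg_pos.2 (clip_neg _ (by linarith)))
      linarith [hs.2])
  refine (mem_solvSet_iff hc hp s).2 ⟨x, y, px, py, dx, fun t => ?_⟩
  have := dy t
  rw [min_eq_left (le_β t), max_eq_right (ge_α t), sub_self, clip_eq (by simp)] at this
  exact this.congr_deriv (by ring)

end main

/-- the solvability set is a nonempty compact interval `[d(p₀), D(p₀)] ⊆ [-b, b]`. -/
theorem solvSet_eq_Icc (c a b T : ℝ) (hc : 0 < c) (ha : 0 < a) (hb : 0 < b) (hT : 0 < T)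
    (p₀ : ℝ → ℝ) (hp₀cont : Continuous p₀) (hp₀per : Function.Periodic p₀ T)
    (hp₀avg : (∫ t in (0:ℝ)..T, p₀ t) = 0) :
    ∃ d D : ℝ, -b ≤ d ∧ d ≤ D ∧ D ≤ b ∧ solvSet c a b T p₀ = Set.Icc d D := by
  obtain ⟨hne, hcpt⟩ := solvSet_nonempty hc ha hb hT hp₀cont hp₀per hp₀avg
  have hord := solvSet_ordConnected hc ha hb hT hp₀cont hp₀per hp₀avg
  have hI := eq_Icc_of_connected_compact ⟨hne, hord.isPreconnected⟩ hcpt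
  have h1 := abs_le.1 (solvSet_bdd hc hb hT hp₀cont hp₀avg (hcpt.sInf_mem hne))
  have h2 := abs_le.1 (solvSet_bdd hc hb hT hp₀cont hp₀avg (hcpt.sSup_mem hne))
  exact ⟨_, _, h1.1, csInf_le hcpt.bddBelow (hcpt.sSup_mem hne), h2.2, hI⟩
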